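/- Let X be a symmetric positive definite n×n real matrix and K a diagonal matrix with 0 ≺ K and K ≺ 2X⁻¹ (in the Loewner order). Then every eigenvalue of the symmetric matrix I − X^{1/2} K X^{1/2} lies in the open interval (−1, 1). -/

import Mathlib

theorem Matrix.IsHermitian.eigenvalues_lt_of_posDef_smul_one_sub {ι : Type*} [Fintype ι]
    [DecidableEq ι] {A : Matrix ι ι ℝ} (hA : A.IsHermitian) {c : ℝ}
    (h : (c • (1 : Matrix ι ι ℝ) - A).PosDef) (i : ι) : hA.eigenvalues i < c := by
  have hv : (hA.eigenvectorBasis i).ofLp ≠ 0 := by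
    simpa using hA.eigenvectorBasis.toBasis.ne_zero i
  have hpos := h.dotProduct_mulVec_pos hv
  rw [Matrix.sub_mulVec, Matrix.smul_mulVec, Matrix.one_mulVec, hA.mulVec_eigenvectorBasis,
    ← sub_smul, dotProduct_smul, smul_eq_mul] at hpos
  exact sub_pos.mp (pos_of_mul_pos_left hpos (dotProduct_star_self_nonneg _))

theorem Matrix.IsHermitian.lt_eigenvalues_of_posDef_sub_smul_one {ι : Type*} [Fintype ι]
    [DecidableEq ι] {A : Matrix ι ι ℝ} (hA : A.IsHermitian) {c : ℝ}
    (h : (A - c • (1 : Matrix ι ι ℝ)).PosDef) (i : ι) : c < hA.eigenvalues i := by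
  have hv : (hA.eigenvectorBasis i).ofLp ≠ 0 := by
    simpa using hA.eigenvectorBasis.toBasis.ne_zero i
  have hpos := h.dotProduct_mulVec_pos hv
  rw [Matrix.sub_mulVec, Matrix.smul_mulVec, Matrix.one_mulVec, hA.mulVec_eigenvectorBasis,
    ← sub_smul, dotProduct_smul, smul_eq_mul] at hpos
  exact sub_pos.mp (pos_of_mul_pos_left hpos (dotProduct_star_self_nonneg _))

theorem stmt_1 {n : ℕ} (X K sqrtX : Matrix (Fin n) (Fin n) ℝ)
    (hX : X.PosDef)
    (hsqrt : sqrtX.PosDef) (hsqrtX : sqrtX * sqrtX = X)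
    (hKdiag : K.IsDiag) (hK : K.PosDef) (hK2 : ((2 : ℝ) • X⁻¹ - K).PosDef)
    (hH : (1 - sqrtX * K * sqrtX).IsHermitian) :
    ∀ i, hH.eigenvalues i ∈ Set.Ioo (-1 : ℝ) 1 := by
  have hstar : star sqrtX = sqrtX := hsqrt.isHermitian
  have hdet : IsUnit sqrtX.det := (Matrix.isUnit_iff_isUnit_det _).mp hsqrt.isUnit
  have hone : sqrtX * X⁻¹ * sqrtX = 1 := by
    rw [← hsqrtX, Matrix.mul_inv_rev, Matrix.mul_nonsing_inv_cancel_left _ _ hdet,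
      Matrix.nonsing_inv_mul _ hdet]
  have hupper := (Matrix.IsUnit.posDef_star_left_conjugate_iff hsqrt.isUnit).mpr hK
  have hlower := (Matrix.IsUnit.posDef_star_left_conjugate_iff hsqrt.isUnit).mpr hK2
  rw [hstar] at hupper hlower
  rw [mul_sub, sub_mul, Matrix.mul_smul, Matrix.smul_mul, hone] at hlower
  refine fun i => ⟨hH.lt_eigenvalues_of_posDef_sub_smul_one ?_ i,
    hH.eigenvalues_lt_of_posDef_smul_one_sub ?_ i⟩
  · convert hlower using 1
    module
  · convert hupper using 1
    module
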